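/- Let k be a field of characteristic zero and V a vector superspace over k. Consider the set of all odd nilpotent endomorphisms x of V such that the pair (V, x) is neat, with the equivalence relation x ~ x' if there exists an even invertible endomorphism g of V with x' = g∘x∘g⁻¹. Then this set has only finitely many equivalence classes. [Finiteness of the number of orbits of neat elements under the adjoint action of the even subgroup, instance G = GL(V).] -/

import Mathlib

open scoped TensorProduct

section Defs

variable (k : Type*) [Field k]

def IsEvenMap {V : Type*} [AddCommGroup V] [Module k V]
    (V0 V1 : Submodule k V) (f : V →ₗ[k] V) : Prop :=
  (∀ v ∈ V0, f v ∈ V0) ∧ (∀ v ∈ V1, f v ∈ V1)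

def IsOddMap {V : Type*} [AddCommGroup V] [Module k V]
    (V0 V1 : Submodule k V) (f : V →ₗ[k] V) : Prop :=
  (∀ v ∈ V0, f v ∈ V1) ∧ (∀ v ∈ V1, f v ∈ V0)

/-- The shift endomorphism of the string module `M_n`: sends basis vector `a_j` to `a_{j+1}`,
and `a_n` to `0`.  In coordinates, `(x f) j = f (j-1)` for `j ≥ 1` and `(x f) 0 = 0`. -/
def shiftMap (n : ℕ) : (Fin (n+1) → k) →ₗ[k] (Fin (n+1) → k) where
  toFun f := fun j =>
    if (j : ℕ) = 0 then 0 else f ⟨(j : ℕ) - 1, Nat.lt_of_le_of_lt (Nat.sub_le _ _) j.isLt⟩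
  map_add' f g := by funext j; simp only [Pi.add_apply]; split_ifs <;> simp
  map_smul' c f := by funext j; simp only [Pi.smul_apply, RingHom.id_apply]; split_ifs <;> simp

/-- The even (`r = 0`) resp. odd (`r = 1`) part of the string module `Π^ε M_n`:
coordinates `j` with `(j + ε) % 2 = r`. -/
def stringPart (n ε r : ℕ) : Submodule k (Fin (n+1) → k) :=
  Submodule.pi Set.univ (fun j => if ((j : ℕ) + ε) % 2 = r then (⊤ : Submodule k k) else ⊥)

/-- Isomorphism of pairs (vector superspace with endomorphism): an even linear isomorphism
intertwining the endomorphisms. -/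
def PairIso {V : Type*} [AddCommGroup V] [Module k V]
    (V0 V1 : Submodule k V) (x : V →ₗ[k] V)
    {W : Type*} [AddCommGroup W] [Module k W]
    (W0 W1 : Submodule k W) (y : W →ₗ[k] W) : Prop :=
  ∃ φ : V ≃ₗ[k] W, (∀ v ∈ V0, φ v ∈ W0) ∧ (∀ v ∈ V1, φ v ∈ W1) ∧ ∀ v, φ (x v) = y (φ v)

/-- `V` decomposes as a direct sum of `x`-invariant graded subspaces, each isomorphic as a pair
to some `Π^ε M_n` with `P n`. -/
def DecomposesIntoStrings {V : Type*} [AddCommGroup V] [Module k V]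
    (V0 V1 : Submodule k V) (x : V →ₗ[k] V) (P : ℕ → Prop) : Prop :=
  ∃ (m : ℕ) (U : Fin m → Submodule k V), DirectSum.IsInternal U ∧
    ∀ i : Fin m, (U i = (U i ⊓ V0) ⊔ (U i ⊓ V1)) ∧
      ∃ (hx : ∀ v ∈ U i, x v ∈ U i) (n ε : ℕ), ε ≤ 1 ∧ P n ∧
        PairIso k (V0.comap (U i).subtype) (V1.comap (U i).subtype) (x.restrict hx)
          (stringPart k n ε 0) (stringPart k n ε 1) (shiftMap k n)

/-- A pair `(V, x)` (odd nilpotent `x`) is neat if it decomposes into strings `Π^ε M_{2s}`. -/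
def IsNeat {V : Type*} [AddCommGroup V] [Module k V]
    (V0 V1 : Submodule k V) (x : V →ₗ[k] V) : Prop :=
  DecomposesIntoStrings k V0 V1 x (fun n => Even n)

end Defs

section Helpers

variable {k : Type*} [Field k]

lemma mem_stringPart (n ε r : ℕ) (f : Fin (n+1) → k) :
    f ∈ stringPart k n ε r ↔ ∀ j : Fin (n+1), ((j : ℕ) + ε) % 2 ≠ r → f j = 0 := by
  simp only [stringPart, Submodule.mem_pi, Set.mem_univ, true_imp_iff]
  refine forall_congr' fun j => ?_
  by_cases h : ((j : ℕ) + ε) % 2 = r <;> simp [h]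

lemma stringPart_inf (n ε : ℕ) (f : Fin (n+1) → k)
    (h0 : f ∈ stringPart k n ε 0) (h1 : f ∈ stringPart k n ε 1) : f = 0 := by
  rw [mem_stringPart] at h0 h1
  funext j
  by_cases h : ((j : ℕ) + ε) % 2 = 0
  · exact h1 j (by omega)
  · exact h0 j h

/-- `x` is of string type `(m, n, ε)`. -/
def HasStringType {V : Type*} [AddCommGroup V] [Module k V] (V0 V1 : Submodule k V)
    (x : V →ₗ[k] V) (m : ℕ) (n ε : Fin m → ℕ) : Prop :=
  ∃ Ψ : ((i : Fin m) → (Fin (n i + 1) → k)) ≃ₗ[k] V,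
    (∀ w, (∀ i, w i ∈ stringPart k (n i) (ε i) 0) → Ψ w ∈ V0) ∧
    (∀ w, (∀ i, w i ∈ stringPart k (n i) (ε i) 1) → Ψ w ∈ V1) ∧
    (∀ w, Ψ (fun i => shiftMap k (n i) (w i)) = x (Ψ w))

lemma exists_split {m : ℕ} (n ε : Fin m → ℕ) (w : (i : Fin m) → (Fin (n i + 1) → k)) :
    ∃ w0 w1 : (i : Fin m) → (Fin (n i + 1) → k),
      (∀ i, w0 i ∈ stringPart k (n i) (ε i) 0) ∧
      (∀ i, w1 i ∈ stringPart k (n i) (ε i) 1) ∧ w = w0 + w1 := by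
  refine ⟨fun i j => if ((j : ℕ) + ε i) % 2 = 0 then w i j else 0,
    fun i j => if ((j : ℕ) + ε i) % 2 = 0 then 0 else w i j, ?_, ?_, ?_⟩
  · intro i
    rw [mem_stringPart]
    intro j hj
    simp [hj]
  · intro i
    rw [mem_stringPart]
    intro j hj
    have : ((j : ℕ) + ε i) % 2 = 0 := by omega
    simp [this]
  · funext i j
    by_cases h : ((j : ℕ) + ε i) % 2 = 0 <;> simp [h]

lemma HasStringType.conj {V : Type*} [AddCommGroup V] [Module k V] {V0 V1 : Submodule k V}
    (hd : Disjoint V0 V1) {x x' : V →ₗ[k] V} {m : ℕ} {n ε : Fin m → ℕ}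
    (h : HasStringType V0 V1 x m n ε) (h' : HasStringType V0 V1 x' m n ε) :
    ∃ g : V ≃ₗ[k] V, IsEvenMap k V0 V1 (g : V →ₗ[k] V) ∧
      x' = (g : V →ₗ[k] V) ∘ₗ x ∘ₗ (g.symm : V →ₗ[k] V) := by
  obtain ⟨Ψ, a0, a1, ax⟩ := h
  obtain ⟨Ψ', b0, b1, bx⟩ := h'
  refine ⟨Ψ.symm ≪≫ₗ Ψ', ⟨?_, ?_⟩, ?_⟩
  · intro v hv
    obtain ⟨w0, w1, h0, h1, hw⟩ := exists_split n ε (Ψ.symm v)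
    have e : v = Ψ w0 + Ψ w1 := by rw [← map_add, ← hw]; simp
    have hz : Ψ w1 = 0 := by
      refine Submodule.disjoint_def.1 hd _ ?_ (a1 _ h1)
      have : Ψ w1 = v - Ψ w0 := by rw [e]; abel
      rw [this]
      exact V0.sub_mem hv (a0 _ h0)
    have hz' : w1 = 0 := by simpa using hz
    rw [hz', add_zero] at hw
    simpa [hw] using b0 _ h0
  · intro v hv
    obtain ⟨w0, w1, h0, h1, hw⟩ := exists_split n ε (Ψ.symm v)
    have e : v = Ψ w0 + Ψ w1 := by rw [← map_add, ← hw]; simp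
    have hz : Ψ w0 = 0 := by
      refine Submodule.disjoint_def.1 hd _ (a0 _ h0) ?_
      have : Ψ w0 = v - Ψ w1 := by rw [e]; abel
      rw [this]
      exact V1.sub_mem hv (a1 _ h1)
    have hz' : w0 = 0 := by simpa using hz
    rw [hz', zero_add] at hw
    simpa [hw] using b1 _ h1
  · ext v
    obtain ⟨w, rfl⟩ := Ψ'.surjective v
    simp [← ax, ← bx]

lemma exists_stringType {V : Type*} [AddCommGroup V] [Module k V] {V0 V1 : Submodule k V}
    {x : V →ₗ[k] V} {P : ℕ → Prop} (h : DecomposesIntoStrings k V0 V1 x P) :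
    ∃ (m : ℕ) (n ε : Fin m → ℕ), (∀ i, ε i ≤ 1) ∧ HasStringType V0 V1 x m n ε := by
  classical
  obtain ⟨m, U, hU, h⟩ := h
  choose hg hx n ε hε hP φ φ0 φ1 φx using h
  refine ⟨m, n, ε, hε, ?_⟩
  let Ψ : ((i : Fin m) → (Fin (n i + 1) → k)) ≃ₗ[k] V :=
    (LinearEquiv.piCongrRight φ).symm ≪≫ₗ
      (DirectSum.linearEquivFunOnFintype k (Fin m) (fun i => U i)).symm ≪≫ₗ
      LinearEquiv.ofBijective (DirectSum.coeLinearMap U) hU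
  have hΨ : ∀ w, Ψ w = ∑ i, ((φ i).symm (w i) : V) := by
    intro w
    have : Ψ w = DirectSum.coeLinearMap U
      ((DirectSum.linearEquivFunOnFintype k (Fin m) (fun i => U i)).symm
        (fun i => (φ i).symm (w i))) := rfl
    rw [this, DirectSum.coeLinearMap_eq_dfinsuppSum, DFinsupp.sum_eq_sum_fintype]
    · rfl
    · simp
  have key : ∀ i (u : U i), ∃ u0 u1 : U i, (u0 : V) ∈ V0 ∧ (u1 : V) ∈ V1 ∧ u = u0 + u1 := by
    intro i u
    have hu := u.2
    have hu' : (u : V) ∈ (U i ⊓ V0) ⊔ (U i ⊓ V1) := by rw [← hg i]; exact hu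
    obtain ⟨a, ha, b, hb, hab⟩ := Submodule.mem_sup.1 hu'
    exact ⟨⟨a, ha.1⟩, ⟨b, hb.1⟩, ha.2, hb.2, Subtype.ext hab.symm⟩
  refine ⟨Ψ, ?_, ?_, ?_⟩
  · intro w hw
    rw [hΨ]
    refine V0.sum_mem fun i _ => ?_
    obtain ⟨u0, u1, h0, h1, e⟩ := key i ((φ i).symm (w i))
    have e2 : φ i u1 = w i - φ i u0 := by
      rw [eq_sub_iff_add_eq, ← map_add, add_comm u1 u0, ← e]; simp
    have hz : φ i u1 = 0 := stringPart_inf (n i) (ε i) _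
      (by rw [e2]; exact Submodule.sub_mem _ (hw i) (φ0 i u0 h0)) (φ1 i u1 h1)
    have hz' : u1 = 0 := by simpa using hz
    rw [e, hz', add_zero]
    exact h0
  · intro w hw
    rw [hΨ]
    refine V1.sum_mem fun i _ => ?_
    obtain ⟨u0, u1, h0, h1, e⟩ := key i ((φ i).symm (w i))
    have e2 : φ i u0 = w i - φ i u1 := by
      rw [eq_sub_iff_add_eq, ← map_add, ← e]; simp
    have hz : φ i u0 = 0 := stringPart_inf (n i) (ε i) _ (φ0 i u0 h0)
      (by rw [e2]; exact Submodule.sub_mem _ (hw i) (φ1 i u1 h1))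
    have hz' : u0 = 0 := by simpa using hz
    rw [e, hz', zero_add]
    exact h1
  · intro w
    rw [hΨ, hΨ, map_sum]
    refine Finset.sum_congr rfl fun i _ => ?_
    have : (φ i).symm (shiftMap k (n i) (w i)) = x.restrict (hx i) ((φ i).symm (w i)) := by
      rw [LinearEquiv.symm_apply_eq, φx]; simp
    rw [this]
    rfl

lemma HasStringType.finrank {V : Type*} [AddCommGroup V] [Module k V] {V0 V1 : Submodule k V}
    {x : V →ₗ[k] V} {m : ℕ} {n ε : Fin m → ℕ} (h : HasStringType V0 V1 x m n ε) :
    Module.finrank k V = ∑ i, (n i + 1) := by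
  obtain ⟨Ψ, -⟩ := h
  rw [← Ψ.finrank_eq, Module.finrank_pi_fintype]
  simp

end Helpers

/-- **Finiteness of the number of orbits of neat elements** under the adjoint action of the
even subgroup (instance `G = GL(V)`): for a vector superspace `V` over a field of
characteristic zero, the set of odd nilpotent endomorphisms `x` with `(V, x)` neat has only
finitely many classes under conjugation by even invertible endomorphisms; equivalently, there
is a finite set of endomorphisms meeting every conjugacy class of neat elements. -/
theorem finitely_many_neat_conjugacy_classes {k : Type*} [Field k] [CharZero k]
    (V : Type*) [AddCommGroup V] [Module k V] [FiniteDimensional k V]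
    (V0 V1 : Submodule k V) (hcompl : IsCompl V0 V1) :
    ∃ reps : Finset (V →ₗ[k] V),
      ∀ x : V →ₗ[k] V, IsOddMap k V0 V1 x → IsNilpotent x → IsNeat k V0 V1 x →
        ∃ x' ∈ reps, ∃ g : V ≃ₗ[k] V, IsEvenMap k V0 V1 (g : V →ₗ[k] V) ∧
          x' = (g : V →ₗ[k] V) ∘ₗ x ∘ₗ (g.symm : V →ₗ[k] V) := by
  classical
  let N := Module.finrank k V
  let T := Σ m : Fin (N+1), (Fin m → Fin (N+1) × Fin 2)
  let R : T → (V →ₗ[k] V) → Prop := fun t x =>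
    HasStringType V0 V1 x t.1 (fun i => (t.2 i).1) (fun i => (t.2 i).2)
  refine ⟨Finset.univ.image
    (fun t : T => if h : ∃ x, R t x then h.choose else 0), ?_⟩
  intro x _ _ hneat
  obtain ⟨m, n, ε, hε, hT⟩ := exists_stringType hneat
  have hN : N = ∑ i, (n i + 1) := hT.finrank
  have hm : m < N + 1 := by
    rw [hN, Finset.sum_add_distrib]
    simp
  have hn : ∀ i, n i < N + 1 := by
    intro i
    have := Finset.single_le_sum (f := fun i => n i + 1) (fun _ _ => Nat.zero_le _)
      (Finset.mem_univ i)
    omega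
  let t : T := ⟨⟨m, hm⟩, fun i => (⟨n i, hn i⟩, ⟨ε i, Nat.lt_succ_of_le (hε i)⟩)⟩
  have hR : R t x := hT
  have hex : ∃ x, R t x := ⟨x, hR⟩
  refine ⟨hex.choose, Finset.mem_image.2 ⟨t, Finset.mem_univ _, dif_pos hex⟩, ?_⟩
  exact HasStringType.conj hcompl.disjoint hR hex.choose_spec
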